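/- There is a constant C > 0 such that for every polymer X ⊂ ℝ², every α > 0, and all functions f, g of class C² on a neighborhood of X: ∫_X |∇(f+g)|² ≤ ∫_X |∇f|² + ∫_X |∇g|² + C·α·( ∫_{∂X} |∇f|² dH¹ + ∫_X |∇²f|² ) + C·α⁻¹·( ∫_{∂X} |g|² dH¹ + ∫_X |g|² ). -/

import Mathlib

open MeasureTheory

noncomputable section

/-- The plane, with its Euclidean structure. -/
abbrev E2 := EuclideanSpace ℝ (Fin 2)

/-- The closed unit square (block) of the standard tessellation of `ℝ²` with lower-left
corner `p ∈ ℤ²`. -/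
def unitSquare (p : ℤ × ℤ) : Set E2 :=
  {x | (p.1 : ℝ) ≤ x 0 ∧ x 0 ≤ (p.1 : ℝ) + 1 ∧ (p.2 : ℝ) ≤ x 1 ∧ x 1 ≤ (p.2 : ℝ) + 1}

/-- The polymer (finite union of closed unit squares) indexed by a finite set `S ⊆ ℤ²`. -/
def polymerOf (S : Finset (ℤ × ℤ)) : Set E2 := ⋃ p ∈ S, unitSquare p

/-- `‖∇ⁿf(x)‖`, the norm of the `n`-th derivative of `f` at `x`. -/
def dNorm (n : ℕ) (f : E2 → ℝ) (x : E2) : ℝ := ‖iteratedFDeriv ℝ n f x‖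



open Set

/-- Coordinates `ℝ × ℝ ≃ E2`. -/
def phiL : (ℝ × ℝ) ≃L[ℝ] E2 :=
  (ContinuousLinearEquiv.finTwoArrow ℝ ℝ).symm.trans
    (PiLp.continuousLinearEquiv 2 ℝ (fun _ : Fin 2 => ℝ)).symm

@[simp] lemma phiL_zero (z : ℝ × ℝ) : phiL z 0 = z.1 := by simp [phiL]
@[simp] lemma phiL_one (z : ℝ × ℝ) : phiL z 1 = z.2 := by simp [phiL]

lemma phiL_mp : MeasurePreserving phiL volume volume := by
  have h1 := (volume_preserving_finTwoArrow ℝ).symm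
  have h2 := PiLp.volume_preserving_toLp (Fin 2)
  exact h2.comp h1

lemma phiL_emb : MeasurableEmbedding phiL := phiL.toHomeomorph.measurableEmbedding

lemma phiL_preimage (p : ℤ × ℤ) :
    phiL ⁻¹' unitSquare p = Icc ((p.1 : ℝ), (p.2 : ℝ)) ((p.1 : ℝ) + 1, (p.2 : ℝ) + 1) := by
  ext z
  simp only [unitSquare, mem_preimage, mem_ofPred_eq, phiL_zero, phiL_one, mem_Icc, Prod.le_def]
  tauto

lemma isCompact_unitSquare (p : ℤ × ℤ) : IsCompact (unitSquare p) := by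
  have : unitSquare p = phiL '' Icc ((p.1 : ℝ), (p.2 : ℝ)) ((p.1 : ℝ) + 1, (p.2 : ℝ) + 1) := by
    rw [← phiL_preimage, image_preimage_eq _ phiL.surjective]
  rw [this]
  exact isCompact_Icc.image phiL.continuous

lemma isCompact_polymer (S : Finset (ℤ × ℤ)) : IsCompact (polymerOf S) :=
  S.isCompact_biUnion fun p _ => isCompact_unitSquare p

lemma null_line (i : Fin 2) (c : ℝ) : volume {x : E2 | x i = c} = 0 := by
  have h2 := PiLp.volume_preserving_ofLp (Fin 2)
  have : {x : E2 | x i = c} = WithLp.ofLp ⁻¹' {v : Fin 2 → ℝ | v i = c} := rfl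
  rw [this, h2.measure_preimage]
  · exact Measure.pi_hyperplane _ _ _
  · exact (measurableSet_eq_fun (measurable_pi_apply i) measurable_const).nullMeasurableSet

lemma int_adj {a b : ℤ} {t : ℝ} (hab : a < b) (h1 : t ≤ a + 1) (h2 : (b : ℝ) ≤ t) :
    t = b := by
  have : (a : ℝ) + 1 ≤ b := by exact_mod_cast hab
  linarith

lemma aedisj {p q : ℤ × ℤ} (h : p ≠ q) : AEDisjoint volume (unitSquare p) (unitSquare q) := by
  by_cases h0 : p.1 = q.1
  · have h1 : p.2 ≠ q.2 := fun h1 => h (Prod.ext h0 h1)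
    refine measure_mono_null (fun x hx => ?_) (null_line 1 (max p.2 q.2 : ℤ))
    obtain ⟨⟨_, _, a, b⟩, _, _, c, d⟩ := hx
    rcases lt_or_gt_of_ne h1 with h1 | h1
    · simpa [max_eq_right h1.le] using int_adj h1 b c
    · simpa [max_eq_left h1.le] using int_adj h1 d a
  · refine measure_mono_null (fun x hx => ?_) (null_line 0 (max p.1 q.1 : ℤ))
    obtain ⟨⟨a, b, _, _⟩, c, d, _, _⟩ := hx
    rcases lt_or_gt_of_ne h0 with h1 | h1
    · simpa [max_eq_right h1.le] using int_adj h1 b c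
    · simpa [max_eq_left h1.le] using int_adj h1 d a

lemma integral_polymer (S : Finset (ℤ × ℤ)) (F : E2 → ℝ) (hF : ContinuousOn F (polymerOf S)) :
    ∫ x in polymerOf S, F x = ∑ p ∈ S, ∫ x in unitSquare p, F x := by
  have h : polymerOf S = ⋃ p : S, unitSquare p := by
    simp [polymerOf, iUnion_subtype]
  have hi := hF.integrableOn_compact (μ := volume) (isCompact_polymer S)
  rw [h] at hi ⊢
  rw [integral_iUnion_ae (fun i => (isCompact_unitSquare _).measurableSet.nullMeasurableSet)
    (fun p q hpq => aedisj (fun h => hpq (Subtype.ext h))) hi, tsum_fintype]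
  exact Finset.sum_coe_sort S (fun p => ∫ x in unitSquare p, F x)

/-- Unit vectors. -/
def ee (i : Fin 2) : E2 := EuclideanSpace.single i 1

lemma phiL_10 : phiL (1, 0) = ee 0 := by
  ext i; fin_cases i <;> simp [ee]
lemma phiL_01 : phiL (0, 1) = ee 1 := by
  ext i; fin_cases i <;> simp [ee]

lemma div_square (p : ℤ × ℤ) {U : Set E2} (hU : IsOpen U) (hp : unitSquare p ⊆ U) (P Q : E2 → ℝ)
    (hP : ContDiffOn ℝ 1 P U) (hQ : ContDiffOn ℝ 1 Q U) :
    ∫ x in unitSquare p, (fderiv ℝ P x (ee 0) + fderiv ℝ Q x (ee 1)) =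
      ((∫ y in Ioo (p.2 : ℝ) (p.2 + 1), P (phiL ((p.1 : ℝ) + 1, y))) -
        ∫ y in Ioo (p.2 : ℝ) (p.2 + 1), P (phiL ((p.1 : ℝ), y))) +
      ((∫ y in Ioo (p.1 : ℝ) (p.1 + 1), Q (phiL (y, (p.2 : ℝ) + 1))) -
        ∫ y in Ioo (p.1 : ℝ) (p.1 + 1), Q (phiL (y, (p.2 : ℝ)))) := by
  rw [← phiL_mp.setIntegral_preimage_emb phiL_emb, phiL_preimage]
  have hm : ∀ z ∈ Icc ((p.1 : ℝ), (p.2 : ℝ)) ((p.1 : ℝ) + 1, (p.2 : ℝ) + 1), phiL z ∈ U := by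
    intro z hz
    rw [← phiL_preimage] at hz
    exact hp hz
  have hd : ∀ R : E2 → ℝ, ContDiffOn ℝ 1 R U → ∀ z, phiL z ∈ U →
      HasFDerivAt (fun z => R (phiL z)) ((fderiv ℝ R (phiL z)).comp (phiL : (ℝ × ℝ) →L[ℝ] E2)) z := by
    intro R hR z hz
    have h1 : DifferentiableAt ℝ R (phiL z) :=
      (hR.differentiableOn (by norm_num)).differentiableAt (hU.mem_nhds hz)
    exact h1.hasFDerivAt.comp z phiL.hasFDerivAt
  have hc : ∀ R : E2 → ℝ, ContDiffOn ℝ 1 R U → ∀ v, ContinuousOn (fun z => fderiv ℝ R (phiL z) v)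
      (Icc ((p.1 : ℝ), (p.2 : ℝ)) ((p.1 : ℝ) + 1, (p.2 : ℝ) + 1)) := by
    intro R hR v
    have h1 := hR.continuousOn_fderiv_of_isOpen hU le_rfl
    exact (h1.comp phiL.continuous.continuousOn hm).clm_apply continuousOn_const
  have key := integral_divergence_prod_Icc_of_hasFDerivAt_of_le
    (fun z => P (phiL z)) (fun z => Q (phiL z))
    (fun z => (fderiv ℝ P (phiL z)).comp (phiL : (ℝ × ℝ) →L[ℝ] E2))
    (fun z => (fderiv ℝ Q (phiL z)).comp (phiL : (ℝ × ℝ) →L[ℝ] E2))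
    ((p.1 : ℝ), (p.2 : ℝ)) ((p.1 : ℝ) + 1, (p.2 : ℝ) + 1) (by simp [Prod.le_def])
    (hP.continuousOn.comp phiL.continuous.continuousOn hm)
    (hQ.continuousOn.comp phiL.continuous.continuousOn hm)
    (fun z hz => hd P hP z (hm z (by
      rw [Icc_prod_eq]; exact prod_mono Ioo_subset_Icc_self Ioo_subset_Icc_self hz)))
    (fun z hz => hd Q hQ z (hm z (by
      rw [Icc_prod_eq]; exact prod_mono Ioo_subset_Icc_self Ioo_subset_Icc_self hz)))
    (by
      refine ContinuousOn.integrableOn_compact isCompact_Icc ?_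
      exact (hc P hP _).add (hc Q hQ _))
  simp only [ContinuousLinearMap.comp_apply, ContinuousLinearEquiv.coe_coe, phiL_10, phiL_01] at key
  rw [key]
  simp only [intervalIntegral.integral_of_le (le_add_of_nonneg_right zero_le_one),
    integral_Ioc_eq_integral_Ioo]
  ring

lemma iso_v (c : ℝ) : Isometry (fun y : ℝ => phiL (c, y)) := by
  refine Isometry.of_dist_eq fun a b => ?_
  rw [EuclideanSpace.dist_eq]; simp [Real.sqrt_sq_eq_abs, Real.dist_eq]
lemma iso_h (c : ℝ) : Isometry (fun y : ℝ => phiL (y, c)) := by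
  refine Isometry.of_dist_eq fun a b => ?_
  rw [EuclideanSpace.dist_eq]; simp [Real.sqrt_sq_eq_abs, Real.dist_eq]

lemma iso_integral {γ : ℝ → E2} (hγ : Isometry γ) (s : Set ℝ) (h : E2 → ℝ) :
    ∫ x in γ '' s, h x ∂(μH[1]) = ∫ t in s, h (γ t) := by
  have e : MeasurableEmbedding γ := hγ.isClosedEmbedding.measurableEmbedding
  have h1 := hγ.map_hausdorffMeasure (d := 1) (Or.inl zero_le_one)
  rw [hausdorffMeasure_real] at h1
  have h2 : (μH[1] : Measure E2).restrict (γ '' s) = (Measure.map γ volume).restrict (γ '' s) := by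
    rw [h1, Measure.restrict_restrict_of_subset (image_subset_range _ _)]
  rw [h2, e.setIntegral_map, preimage_image_eq _ hγ.injective]

lemma edge_sum {ι : Type*} (A : Set E2) (B : Finset ι) (γ : ι → ℝ → E2) (a : ι → ℝ)
    (hγ : ∀ q, Isometry (γ q))
    (hdis : ∀ q ∈ B, ∀ q' ∈ B, q ≠ q' →
      Disjoint (γ q '' Ioo (a q) (a q + 1)) (γ q' '' Ioo (a q') (a q' + 1)))
    (hA : ∀ q ∈ B, γ q '' Ioo (a q) (a q + 1) ⊆ A) (h : E2 → ℝ) (h0 : ∀ x, 0 ≤ h x)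
    (hi : IntegrableOn h A μH[1]) :
    ∑ q ∈ B, ∫ t in Ioo (a q) (a q + 1), h (γ q t) ≤ ∫ x in A, h x ∂(μH[1]) := by
  simp_rw [← fun q => iso_integral (hγ q) (Ioo (a q) (a q + 1)) h]
  rw [← integral_biUnion_finset B
    (fun q _ => (hγ q).isClosedEmbedding.measurableEmbedding.measurableSet_image.2 measurableSet_Ioo)
    (fun q hq q' hq' hne => hdis q hq q' hq' hne) (fun q hq => hi.mono_set (hA q hq))]
  exact setIntegral_mono_set hi (Filter.Eventually.of_forall h0)
    (Filter.Eventually.of_forall (iUnion₂_subset hA))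

/-- Open square. -/
def openSq (p : ℤ × ℤ) : Set E2 :=
  phiL '' (Ioo (p.1 : ℝ) (p.1 + 1) ×ˢ Ioo (p.2 : ℝ) (p.2 + 1))

lemma isOpen_openSq (p : ℤ × ℤ) : IsOpen (openSq p) :=
  phiL.toHomeomorph.isOpenMap _ (isOpen_Ioo.prod isOpen_Ioo)

lemma mem_openSq {p : ℤ × ℤ} {x : E2} : x ∈ openSq p ↔
    ((p.1 : ℝ) < x 0 ∧ x 0 < p.1 + 1) ∧ ((p.2 : ℝ) < x 1 ∧ x 1 < p.2 + 1) := by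
  obtain ⟨z, rfl⟩ := phiL.surjective x
  simp [openSq, phiL.injective.mem_set_image]

lemma unitSquare_subset_closure (p : ℤ × ℤ) : unitSquare p ⊆ closure (openSq p) := by
  intro x hx
  obtain ⟨z, rfl⟩ := phiL.surjective x
  have hz : z ∈ phiL ⁻¹' unitSquare p := hx
  rw [phiL_preimage, Icc_prod_eq] at hz
  have h : phiL z ∈ phiL '' closure (Ioo (p.1 : ℝ) (p.1 + 1) ×ˢ Ioo (p.2 : ℝ) (p.2 + 1)) := by
    refine mem_image_of_mem _ ?_
    rw [closure_prod_eq, closure_Ioo (by simp), closure_Ioo (by simp)]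
    exact hz
  exact image_closure_subset_closure_image phiL.continuous h

lemma int_uniq {a b : ℤ} {t : ℝ} (h1 : (a : ℝ) < t) (h2 : t < a + 1) (h3 : (b : ℝ) ≤ t)
    (h4 : t ≤ b + 1) : b = a := by
  have h5 : (a : ℝ) < b + 1 := by linarith
  have h6 : (b : ℝ) < a + 1 := by linarith
  have h5' : a < b + 1 := by exact_mod_cast h5
  have h6' : b < a + 1 := by exact_mod_cast h6
  omega

lemma openSq_disj {S : Finset (ℤ × ℤ)} {p : ℤ × ℤ} (hp : p ∉ S) : openSq p ⊆ (polymerOf S)ᶜ := by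
  intro x hx hX
  simp only [polymerOf, mem_iUnion] at hX
  obtain ⟨q, hq, a, b, c, d⟩ := hX
  obtain ⟨⟨a', b'⟩, c', d'⟩ := mem_openSq.1 hx
  have : q = p := Prod.ext (int_uniq a' b' a b) (int_uniq c' d' c d)
  exact hp (this ▸ hq)

lemma mem_frontier_of {S : Finset (ℤ × ℤ)} {p q : ℤ × ℤ} (hp : p ∈ S) (hq : q ∉ S) {x : E2}
    (h1 : x ∈ unitSquare p) (h2 : x ∈ unitSquare q) : x ∈ frontier (polymerOf S) := by
  rw [frontier_eq_closure_inter_closure]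
  exact ⟨subset_closure (mem_biUnion (show p ∈ (S : Set _) from hp) h1),
    closure_mono (openSq_disj hq) (unitSquare_subset_closure q h2)⟩

lemma frontier_finite (S : Finset (ℤ × ℤ)) : μH[1] (frontier (polymerOf S)) < ⊤ := by
  have hE : ∀ γ : ℝ → E2, Isometry γ → ∀ a : ℝ, μH[1] (γ '' Icc a (a + 1)) < ⊤ := by
    intro γ hγ a
    rw [hγ.hausdorffMeasure_image (Or.inl zero_le_one), hausdorffMeasure_real]
    simp
  have hsub : frontier (polymerOf S) ⊆ ⋃ p ∈ S,
      (((fun y : ℝ => phiL ((p.1 : ℝ), y)) '' Icc (p.2 : ℝ) (p.2 + 1) ∪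
        (fun y : ℝ => phiL ((p.1 : ℝ) + 1, y)) '' Icc (p.2 : ℝ) (p.2 + 1)) ∪
       ((fun y : ℝ => phiL (y, (p.2 : ℝ))) '' Icc (p.1 : ℝ) (p.1 + 1) ∪
        (fun y : ℝ => phiL (y, (p.2 : ℝ) + 1)) '' Icc (p.1 : ℝ) (p.1 + 1))) := by
    intro x hx
    have hX := (isCompact_polymer S).isClosed.frontier_subset hx
    simp only [polymerOf, mem_iUnion] at hX
    obtain ⟨p, hp, hpx⟩ := hX
    have hno : x ∉ openSq p := by
      intro ho
      have : openSq p ⊆ interior (polymerOf S) := by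
        refine interior_maximal ?_ (isOpen_openSq p)
        intro y hy
        obtain ⟨⟨a', b'⟩, c', d'⟩ := mem_openSq.1 hy
        exact mem_biUnion (show p ∈ (S : Set _) from hp) ⟨a'.le, b'.le, c'.le, d'.le⟩
      exact hx.2 (this ho)
    simp only [mem_iUnion]
    refine ⟨p, hp, ?_⟩
    obtain ⟨z, rfl⟩ := phiL.surjective x
    obtain ⟨z0, z1⟩ := z
    rw [mem_openSq] at hno
    obtain ⟨a, b, c, d⟩ := hpx
    simp only [phiL_zero, phiL_one] at a b c d hno
    by_cases e1 : z0 = p.1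
    · exact Or.inl (Or.inl ⟨z1, ⟨c, d⟩, by rw [e1]⟩)
    by_cases e2 : z0 = p.1 + 1
    · exact Or.inl (Or.inr ⟨z1, ⟨c, d⟩, by rw [e2]⟩)
    by_cases e3 : z1 = p.2
    · exact Or.inr (Or.inl ⟨z0, ⟨a, b⟩, by rw [e3]⟩)
    by_cases e4 : z1 = p.2 + 1
    · exact Or.inr (Or.inr ⟨z0, ⟨a, b⟩, by rw [e4]⟩)
    exact absurd ⟨⟨lt_of_le_of_ne a (Ne.symm e1), lt_of_le_of_ne b e2⟩,
      lt_of_le_of_ne c (Ne.symm e3), lt_of_le_of_ne d e4⟩ hno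
  refine lt_of_le_of_lt (measure_mono hsub) ?_
  refine measure_biUnion_lt_top S.finite_toSet fun p _ => ?_
  exact measure_union_lt_top
    (measure_union_lt_top (hE _ (iso_v _) _) (hE _ (iso_v _) _))
    (measure_union_lt_top (hE _ (iso_h _) _) (hE _ (iso_h _) _))

lemma isCompact_fr (S : Finset (ℤ × ℤ)) : IsCompact (frontier (polymerOf S)) :=
  (isCompact_polymer S).of_isClosed_subset isClosed_frontier
    (isCompact_polymer S).isClosed.frontier_subset

lemma integrable_fr (S : Finset (ℤ × ℤ)) (h : E2 → ℝ) (hc : ContinuousOn h (polymerOf S)) :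
    IntegrableOn h (frontier (polymerOf S)) μH[1] := by
  have hc' := hc.mono (isCompact_polymer S).isClosed.frontier_subset
  obtain ⟨M, hM⟩ := (isCompact_fr S).exists_bound_of_continuousOn hc'
  have : IsFiniteMeasure ((μH[1] : Measure E2).restrict (frontier (polymerOf S))) :=
    ⟨by simpa using frontier_finite S⟩
  exact Integrable.of_bound
    (hc'.aestronglyMeasurable (isCompact_fr S).measurableSet)
    M ((ae_restrict_iff' (isCompact_fr S).measurableSet).2 (Filter.Eventually.of_forall hM))

lemma dir_bound (S : Finset (ℤ × ℤ)) (e : ℤ × ℤ) (γ : ℤ × ℤ → ℝ → E2) (a : ℤ × ℤ → ℝ)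
    (hγ : ∀ q, Isometry (γ q))
    (hdis : ∀ q q', q ≠ q' →
      Disjoint (γ q '' Ioo (a q) (a q + 1)) (γ q' '' Ioo (a q') (a q' + 1)))
    (h1 : ∀ q, ∀ t ∈ Ioo (a q) (a q + 1), γ q t ∈ unitSquare q)
    (h2 : ∀ q, ∀ t ∈ Ioo (a q) (a q + 1), γ q t ∈ unitSquare (q - e))
    (P : E2 → ℝ) (hP : ContinuousOn P (polymerOf S)) :
    ∑ p ∈ S, ((∫ t in Ioo (a (p + e)) (a (p + e) + 1), P (γ (p + e) t)) -
      ∫ t in Ioo (a p) (a p + 1), P (γ p t)) ≤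
    ∫ x in frontier (polymerOf S), |P x| ∂(μH[1]) := by
  classical
  set V : ℤ × ℤ → ℝ := fun q => ∫ t in Ioo (a q) (a q + 1), P (γ q t) with hV
  set T := S.image (· + e) with hT
  have hsum : ∑ p ∈ S, V (p + e) = ∑ q ∈ T, V q := by
    rw [hT, Finset.sum_image (fun x _ y _ h => add_right_cancel h)]
  have hB : ∑ q ∈ T, V q - ∑ q ∈ S, V q ≤ ∑ q ∈ (T \ S) ∪ (S \ T), |V q| := by
    rw [Finset.sum_union (Finset.disjoint_left.2 (by simp; tauto)),
      ← Finset.sum_sdiff_sub_sum_sdiff]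
    have e1 : ∑ q ∈ T \ S, V q ≤ ∑ q ∈ T \ S, |V q| :=
      Finset.sum_le_sum fun _ _ => le_abs_self _
    have e2 : -∑ q ∈ S \ T, V q ≤ ∑ q ∈ S \ T, |V q| := by
      rw [← Finset.sum_neg_distrib]
      exact Finset.sum_le_sum fun _ _ => neg_le_abs _
    linarith
  have hmem : ∀ q ∈ (T \ S) ∪ (S \ T), γ q '' Ioo (a q) (a q + 1) ⊆ frontier (polymerOf S) := by
    rintro q hq _ ⟨t, ht, rfl⟩
    have hqT : q ∈ T ↔ q - e ∈ S := by
      simp only [hT, Finset.mem_image]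
      constructor
      · rintro ⟨p, hp, rfl⟩; simpa using hp
      · intro h; exact ⟨_, h, by simp⟩
    simp only [Finset.mem_union, Finset.mem_sdiff, hqT] at hq
    rcases hq with ⟨ha, hb⟩ | ⟨ha, hb⟩
    · exact mem_frontier_of ha hb (h2 q t ht) (h1 q t ht)
    · exact mem_frontier_of ha hb (h1 q t ht) (h2 q t ht)
  have hfin := edge_sum (frontier (polymerOf S)) ((T \ S) ∪ (S \ T)) γ a hγ
    (fun q _ q' _ h => hdis q q' h) hmem (fun x => |P x|) (fun x => abs_nonneg _)
    (integrable_fr S _ hP.abs)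
  rw [Finset.sum_sub_distrib]
  change ∑ p ∈ S, V (p + e) - ∑ p ∈ S, V p ≤ _
  rw [hsum]
  refine hB.trans (le_trans (Finset.sum_le_sum fun q _ => ?_) hfin)
  exact abs_integral_le_integral_abs

lemma div_polymer (S : Finset (ℤ × ℤ)) {U : Set E2} (hU : IsOpen U) (hS : polymerOf S ⊆ U)
    (P Q : E2 → ℝ) (hP : ContDiffOn ℝ 1 P U) (hQ : ContDiffOn ℝ 1 Q U) :
    ∫ x in polymerOf S, (fderiv ℝ P x (ee 0) + fderiv ℝ Q x (ee 1)) ≤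
      (∫ x in frontier (polymerOf S), |P x| ∂(μH[1])) +
      ∫ x in frontier (polymerOf S), |Q x| ∂(μH[1]) := by
  have hc : ∀ R : E2 → ℝ, ContDiffOn ℝ 1 R U → ∀ v, ContinuousOn (fun z => fderiv ℝ R z v)
      (polymerOf S) := fun R hR v =>
    ((hR.continuousOn_fderiv_of_isOpen hU le_rfl).mono hS).clm_apply continuousOn_const
  rw [integral_polymer S (fun x => fderiv ℝ P x (ee 0) + fderiv ℝ Q x (ee 1))
    ((hc P hP _).add (hc Q hQ _))]
  have h1 : ∀ p ∈ S, unitSquare p ⊆ U := fun p hp =>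
    (subset_biUnion_of_mem (u := unitSquare) (show p ∈ (S : Set _) from hp)).trans hS
  rw [Finset.sum_congr rfl fun p hp => div_square p hU (h1 p hp) P Q hP hQ,
    Finset.sum_add_distrib]
  have dv := dir_bound S (1, 0) (fun q y => phiL ((q.1 : ℝ), y)) (fun q => (q.2 : ℝ))
    (fun q => iso_v _) ?_ ?_ ?_ P (hP.continuousOn.mono hS)
  have dh := dir_bound S (0, 1) (fun q y => phiL (y, (q.2 : ℝ))) (fun q => (q.1 : ℝ))
    (fun q => iso_h _) ?_ ?_ ?_ Q (hQ.continuousOn.mono hS)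
  · simp only [Prod.fst_add, Prod.snd_add, add_zero, Int.cast_add, Int.cast_one] at dv dh
    exact add_le_add dv dh
  · intro q q' hne
    rw [disjoint_left]
    rintro _ ⟨t, ht, rfl⟩ ⟨s, hs, he⟩
    have he' := phiL.injective he
    simp only [Prod.mk.injEq, Int.cast_inj] at he'
    obtain ⟨e1, e2⟩ := he'
    subst e1
    exact hne (Prod.ext (int_uniq hs.1 hs.2 ht.1.le ht.2.le) e2.symm)
  · intro q t ht
    simp [unitSquare, ht.1.le, ht.2.le]
  · intro q t ht
    simp [unitSquare, ht.1.le, ht.2.le]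
  · intro q q' hne
    rw [disjoint_left]
    rintro _ ⟨t, ht, rfl⟩ ⟨s, hs, he⟩
    have he' := phiL.injective he
    simp only [Prod.mk.injEq, Int.cast_inj] at he'
    obtain ⟨e1, e2⟩ := he'
    subst e2
    exact hne (Prod.ext e1.symm (int_uniq hs.1 hs.2 ht.1.le ht.2.le))
  · intro q t ht
    simp [unitSquare, ht.1.le, ht.2.le]
  · intro q t ht
    simp [unitSquare, ht.1.le, ht.2.le]

lemma norm_sq_dual (L : E2 →L[ℝ] ℝ) : ‖L‖ ^ 2 = L (ee 0) ^ 2 + L (ee 1) ^ 2 := by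
  obtain ⟨v, rfl⟩ := (InnerProductSpace.toDual ℝ E2).surjective L
  rw [LinearIsometryEquiv.norm_map, EuclideanSpace.norm_sq_eq]
  simp [ee, InnerProductSpace.toDual_apply_apply, EuclideanSpace.inner_single_right]

lemma norm_ee (i : Fin 2) : ‖ee i‖ = 1 := by simp [ee]

lemma abs_second_le (f : E2 → ℝ) (x : E2) (i : Fin 2) :
    |fderiv ℝ (fderiv ℝ f) x (ee i) (ee i)| ≤ dNorm 2 f x := by
  have h := (iteratedFDeriv ℝ 2 f x).le_opNorm ![ee i, ee i]
  rw [iteratedFDeriv_two_apply] at h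
  simpa [Fin.prod_univ_two, norm_ee, dNorm] using h

lemma integral_five {μ : Measure E2} {a b d k l : E2 → ℝ} (r s t : ℝ) (ha : Integrable a μ)
    (hb : Integrable b μ) (hd : Integrable d μ) (hk : Integrable k μ) (hl : Integrable l μ) :
    ∫ x, (a x + b x + r * d x + (s * k x + t * l x)) ∂μ =
      (∫ x, a x ∂μ) + (∫ x, b x ∂μ) + r * (∫ x, d x ∂μ) +
        (s * (∫ x, k x ∂μ) + t * ∫ x, l x ∂μ) := by
  have e1 : Integrable (fun x => a x + b x) μ := ha.add hb
  have e2 : Integrable (fun x => r * d x) μ := hd.const_mul r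
  have e3 : Integrable (fun x => s * k x) μ := hk.const_mul s
  have e4 : Integrable (fun x => t * l x) μ := hl.const_mul t
  have e5 : Integrable (fun x => a x + b x + r * d x) μ := e1.add e2
  have e6 : Integrable (fun x => s * k x + t * l x) μ := e3.add e4
  rw [integral_add e5 e6, integral_add e1 e2, integral_add ha hb, integral_add e3 e4,
    integral_const_mul, integral_const_mul, integral_const_mul]

theorem stmt6 :
    ∃ C : ℝ, 0 < C ∧
      ∀ S : Finset (ℤ × ℤ), S.Nonempty →
        ∀ α : ℝ, 0 < α →
          ∀ (f g : E2 → ℝ) (U : Set E2), IsOpen U → polymerOf S ⊆ U →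
            ContDiffOn ℝ 2 f U → ContDiffOn ℝ 2 g U →
            (∫ x in polymerOf S, ‖fderiv ℝ (fun y => f y + g y) x‖ ^ 2) ≤
              (∫ x in polymerOf S, ‖fderiv ℝ f x‖ ^ 2) +
              (∫ x in polymerOf S, ‖fderiv ℝ g x‖ ^ 2) +
              C * α * ((∫ x in frontier (polymerOf S), ‖fderiv ℝ f x‖ ^ 2 ∂(μH[1])) +
                       (∫ x in polymerOf S, dNorm 2 f x ^ 2)) +
              C * α⁻¹ * ((∫ x in frontier (polymerOf S), g x ^ 2 ∂(μH[1])) +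
                         (∫ x in polymerOf S, g x ^ 2)) := by
  refine ⟨4, by norm_num, ?_⟩
  intro S _ α hα f g U hU hS hf hg
  have hX := isCompact_polymer S
  have hXm : MeasurableSet (polymerOf S) := hX.measurableSet
  have hFm : MeasurableSet (frontier (polymerOf S)) := (isCompact_fr S).measurableSet
  have hFX : frontier (polymerOf S) ⊆ polymerOf S := hX.isClosed.frontier_subset
  have hDf : ContDiffOn ℝ 1 (fderiv ℝ f) U := hf.fderiv_of_isOpen hU (by norm_num)
  have hg1 : ContDiffOn ℝ 1 g U := hg.of_le (by norm_num)
  have hPi : ∀ i, ContDiffOn ℝ 1 (fun x => g x * fderiv ℝ f x (ee i)) U := fun i =>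
    hg1.mul (hDf.clm_apply contDiffOn_const)
  -- continuity facts on X
  have cDf : ContinuousOn (fderiv ℝ f) (polymerOf S) := hDf.continuousOn.mono hS
  have cg : ContinuousOn g (polymerOf S) := hg1.continuousOn.mono hS
  have cDg : ContinuousOn (fderiv ℝ g) (polymerOf S) :=
    (hg1.continuousOn_fderiv_of_isOpen hU le_rfl).mono hS
  have cD2 : ContinuousOn (dNorm 2 f) (polymerOf S) := by
    have h : ContinuousOn (iteratedFDeriv ℝ 2 f) U := by
      have h1 := hf.continuousOn_iteratedFDerivWithin (m := 2) le_rfl hU.uniqueDiffOn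
      exact h1.congr fun x hx => (iteratedFDerivWithin_of_isOpen 2 hU hx).symm
    exact (h.mono hS).norm
  have cP : ∀ i, ContinuousOn
      (fun x => fderiv ℝ (fun x => g x * fderiv ℝ f x (ee i)) x (ee i)) (polymerOf S) := fun i =>
    (((hPi i).continuousOn_fderiv_of_isOpen hU le_rfl).mono hS).clm_apply continuousOn_const
  -- pointwise bound in X
  have hpt : ∀ x ∈ polymerOf S, ‖fderiv ℝ (fun y => f y + g y) x‖ ^ 2 ≤
      ‖fderiv ℝ f x‖ ^ 2 + ‖fderiv ℝ g x‖ ^ 2 +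
      2 * (fderiv ℝ (fun x => g x * fderiv ℝ f x (ee 0)) x (ee 0) +
        fderiv ℝ (fun x => g x * fderiv ℝ f x (ee 1)) x (ee 1)) +
      (4 * α * dNorm 2 f x ^ 2 + α⁻¹ * g x ^ 2) := by
    intro x hx
    have hxU := hU.mem_nhds (hS hx)
    have df : DifferentiableAt ℝ f x := (hf.differentiableOn (by norm_num)).differentiableAt hxU
    have dg : DifferentiableAt ℝ g x := (hg.differentiableOn (by norm_num)).differentiableAt hxU
    have ddf : DifferentiableAt ℝ (fderiv ℝ f) x :=
      (hDf.differentiableOn (by norm_num)).differentiableAt hxU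
    have hadd : fderiv ℝ (fun y => f y + g y) x = fderiv ℝ f x + fderiv ℝ g x := fderiv_add df dg
    have hder : ∀ i, fderiv ℝ (fun x => g x * fderiv ℝ f x (ee i)) x (ee i) =
        g x * fderiv ℝ (fderiv ℝ f) x (ee i) (ee i) +
          fderiv ℝ f x (ee i) * fderiv ℝ g x (ee i) := by
      intro i
      have h2 : HasFDerivAt (fun x => fderiv ℝ f x (ee i))
          ((ContinuousLinearMap.apply ℝ ℝ (ee i)).comp (fderiv ℝ (fderiv ℝ f) x)) x :=
        (ContinuousLinearMap.apply ℝ ℝ (ee i)).hasFDerivAt.comp x ddf.hasFDerivAt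
      have h3 := (dg.hasFDerivAt.mul h2).fderiv
      change fderiv ℝ (fun x => g x * fderiv ℝ f x (ee i)) x = _ at h3
      rw [h3]
      simp
    rw [hadd, norm_sq_dual, norm_sq_dual, norm_sq_dual, hder, hder]
    have b0 := abs_second_le f x 0
    have b1 := abs_second_le f x 1
    simp only [add_apply]
    set A := fderiv ℝ (fderiv ℝ f) x (ee 0) (ee 0)
    set B := fderiv ℝ (fderiv ℝ f) x (ee 1) (ee 1)
    set D := dNorm 2 f x
    have hAB : (A + B) ^ 2 ≤ 4 * D ^ 2 := by
      have : |A + B| ≤ 2 * D := (abs_add_le _ _).trans (by linarith)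
      have := sq_le_sq' (abs_le.1 this).1 (abs_le.1 this).2
      linarith
    have hy : -(2 * (g x * (A + B))) ≤ α * (A + B) ^ 2 + α⁻¹ * g x ^ 2 := by
      have h1 : 0 ≤ α⁻¹ * (α * (A + B) + g x) ^ 2 := by positivity
      have h2 : α⁻¹ * (α * (A + B) + g x) ^ 2 =
          α * (A + B) ^ 2 + 2 * (g x * (A + B)) + α⁻¹ * g x ^ 2 := by
        field_simp; ring
      linarith
    have hz := mul_le_mul_of_nonneg_left hAB hα.le
    nlinarith
  have iX : ∀ h : E2 → ℝ, ContinuousOn h (polymerOf S) → IntegrableOn h (polymerOf S) :=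
    fun h hc => hc.integrableOn_compact hX
  have cL : ContinuousOn (fun x => ‖fderiv ℝ (fun y => f y + g y) x‖ ^ 2) (polymerOf S) :=
    ((((hf.of_le (by norm_num : (1 : WithTop ℕ∞) ≤ 2)).add hg1).continuousOn_fderiv_of_isOpen hU
      le_rfl).mono hS).norm.pow 2
  have i1 := iX _ (cDf.norm.pow 2)
  have i2 := iX _ (cDg.norm.pow 2)
  have i3 := iX _ ((cP 0).add (cP 1))
  have i4 := iX _ (cD2.pow 2)
  have i5 := iX _ (cg.pow 2)
  have hint := setIntegral_mono_on (iX _ cL)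
    (((i1.add i2).add (i3.const_mul 2)).add ((i4.const_mul (4 * α)).add (i5.const_mul α⁻¹))) hXm hpt
  have h5 := integral_five 2 (4 * α) α⁻¹ i1 i2 i3 i4 i5
  simp only [Pi.add_apply, Pi.pow_apply] at hint h5
  rw [h5] at hint
  have hdiv := div_polymer S hU hS _ _ (hPi 0) (hPi 1)
  have j1 := integrable_fr S (fun x => ‖fderiv ℝ f x‖ ^ 2) (cDf.norm.pow 2)
  have j2 := integrable_fr S (fun x => g x ^ 2) (cg.pow 2)
  have hbd : ∀ i, 2 * ∫ x in frontier (polymerOf S), |g x * fderiv ℝ f x (ee i)| ∂(μH[1]) ≤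
      α * (∫ x in frontier (polymerOf S), ‖fderiv ℝ f x‖ ^ 2 ∂(μH[1])) +
      α⁻¹ * ∫ x in frontier (polymerOf S), g x ^ 2 ∂(μH[1]) := by
    intro i
    rw [← integral_const_mul, ← integral_const_mul, ← integral_const_mul,
      ← integral_add (j1.const_mul α) (j2.const_mul α⁻¹)]
    refine setIntegral_mono_on
      ((integrable_fr S _ ((hPi i).continuousOn.mono hS).abs).const_mul 2)
      ((j1.const_mul α).add (j2.const_mul α⁻¹)) hFm ?_
    intro x _
    have h1 : |fderiv ℝ f x (ee i)| ≤ ‖fderiv ℝ f x‖ := by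
      simpa [norm_ee] using (fderiv ℝ f x).le_opNorm (ee i)
    rw [abs_mul]
    have h2 : |g x| * |fderiv ℝ f x (ee i)| ≤ |g x| * ‖fderiv ℝ f x‖ :=
      mul_le_mul_of_nonneg_left h1 (abs_nonneg _)
    have h3 : 0 ≤ α⁻¹ * (α * ‖fderiv ℝ f x‖ - |g x|) ^ 2 := by positivity
    have h4 : α⁻¹ * (α * ‖fderiv ℝ f x‖ - |g x|) ^ 2 =
        α * ‖fderiv ℝ f x‖ ^ 2 - 2 * (|g x| * ‖fderiv ℝ f x‖) + α⁻¹ * |g x| ^ 2 := by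
      field_simp; ring
    rw [sq_abs] at h4
    linarith
  have hb0 := hbd 0
  have hb1 := hbd 1
  have n1 : 0 ≤ α * ∫ x in frontier (polymerOf S), ‖fderiv ℝ f x‖ ^ 2 ∂(μH[1]) :=
    mul_nonneg hα.le (integral_nonneg fun x => by positivity)
  have n2 : 0 ≤ α⁻¹ * ∫ x in frontier (polymerOf S), g x ^ 2 ∂(μH[1]) :=
    mul_nonneg (inv_pos.2 hα).le (integral_nonneg fun x => by positivity)
  have n3 : 0 ≤ α⁻¹ * ∫ x in polymerOf S, g x ^ 2 :=
    mul_nonneg (inv_pos.2 hα).le (integral_nonneg fun x => by positivity)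
  nlinarith

end
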